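/- There is no constant C > 0 such that ∫_{ℝ²} |∇u|² dx ≤ C (∫_{ℝ²} |Δu| dx)² holds for all real-valued u ∈ C_0^∞(ℝ²). Equivalently: for every C > 0 there exists u ∈ C_0^∞(ℝ²) with ∫_{ℝ²} |∇u|² dx > C (∫_{ℝ²} |Δu| dx)². -/

import Mathlib

open MeasureTheory
open scoped Real

noncomputable section

/-- Euclidean plane. -/
abbrev E2 := EuclideanSpace ℝ (Fin 2)

/-- Partial derivative of a real-valued function on `ℝ²` in the `i`-th coordinate
direction. -/
def pdR (i : Fin 2) (u : E2 → ℝ) (x : E2) : ℝ :=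
  fderiv ℝ u x (EuclideanSpace.single i 1)

/-- The Laplacian of a real-valued function on `ℝ²`. -/
def lapR (u : E2 → ℝ) (x : E2) : ℝ :=
  pdR 0 (pdR 0 u) x + pdR 1 (pdR 1 u) x

/-- The partial derivatives of a radial function `x ↦ G (‖x‖ ^ 2)`. -/
lemma pdR_comp_norm_sq {G G' : ℝ → ℝ} (hG : ∀ s, 0 ≤ s → HasDerivAt G (G' s) s) (i : Fin 2) :
    pdR i (fun x => G (‖x‖ ^ 2)) = fun x => G' (‖x‖ ^ 2) * (2 * x i) := by
  funext x
  have h := (hG (‖x‖ ^ 2) (sq_nonneg _)).comp_hasFDerivAt x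
    (hasStrictFDerivAt_norm_sq x).hasFDerivAt
  unfold pdR
  rw [show (fun x : E2 => G (‖x‖ ^ 2)) = G ∘ fun x : E2 => ‖x‖ ^ 2 from rfl, h.fderiv]
  simp [EuclideanSpace.inner_single_right]

lemma pdR_pdR_comp_norm_sq {G G' G'' : ℝ → ℝ} (hG : ∀ s, 0 ≤ s → HasDerivAt G (G' s) s)
    (hG' : ∀ s, 0 ≤ s → HasDerivAt G' (G'' s) s) (i : Fin 2) (x : E2) :
    pdR i (pdR i (fun x => G (‖x‖ ^ 2))) x =
      4 * G'' (‖x‖ ^ 2) * x i ^ 2 + 2 * G' (‖x‖ ^ 2) := by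
  rw [pdR_comp_norm_sq hG]
  have h := (hG' (‖x‖ ^ 2) (sq_nonneg _)).comp_hasFDerivAt x
    (hasStrictFDerivAt_norm_sq x).hasFDerivAt
  have hi : HasFDerivAt (fun x : E2 => 2 * x i)
      ((2 : ℝ) • (EuclideanSpace.proj i : E2 →L[ℝ] ℝ)) x :=
    (EuclideanSpace.proj i : E2 →L[ℝ] ℝ).hasFDerivAt.const_mul 2
  unfold pdR
  rw [show (fun x : E2 => G' (‖x‖ ^ 2) * (2 * x i)) =
    (G' ∘ fun x : E2 => ‖x‖ ^ 2) * fun x : E2 => 2 * x i from rfl, (h.mul hi).fderiv]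
  simp [EuclideanSpace.inner_single_right]
  ring

lemma norm_sq_eq_coord (x : E2) : ‖x‖ ^ 2 = x 0 ^ 2 + x 1 ^ 2 := by
  rw [EuclideanSpace.real_norm_sq_eq, Fin.sum_univ_two]

/-- The Laplacian of a radial function `x ↦ G (‖x‖ ^ 2)`. -/
lemma lapR_comp_norm_sq {G G' G'' : ℝ → ℝ} (hG : ∀ s, 0 ≤ s → HasDerivAt G (G' s) s)
    (hG' : ∀ s, 0 ≤ s → HasDerivAt G' (G'' s) s) (x : E2) :
    lapR (fun x => G (‖x‖ ^ 2)) x =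
      4 * (G' (‖x‖ ^ 2) + ‖x‖ ^ 2 * G'' (‖x‖ ^ 2)) := by
  unfold lapR
  rw [pdR_pdR_comp_norm_sq hG hG', pdR_pdR_comp_norm_sq hG hG']
  linear_combination (-4 * G'' (‖x‖ ^ 2)) * norm_sq_eq_coord x

lemma integrable_inv_norm_sq_add_one_sq :
    Integrable fun x : E2 => 1 / (‖x‖ ^ 2 + 1) ^ 2 := by
  have h := integrable_rpow_neg_one_add_norm_sq (E := E2) (μ := volume) (r := 4) (by simp; norm_num)
  refine h.congr (Filter.Eventually.of_forall fun x => ?_)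
  have : (-4 / 2 : ℝ) = -(2 : ℕ) := by norm_num
  simp only [this]
  rw [Real.rpow_neg (by positivity), Real.rpow_natCast, one_div, add_comm]

lemma rescaled_eq {δ : ℝ} (hδ : 0 < δ) (x : E2) :
    δ ^ 2 / (‖x‖ ^ 2 + δ ^ 2) ^ 2 = (δ ^ 2)⁻¹ * (1 / (‖δ⁻¹ • x‖ ^ 2 + 1) ^ 2) := by
  rw [norm_smul, Real.norm_of_nonneg (by positivity)]
  field_simp

lemma integrable_rescaled {δ : ℝ} (hδ : 0 < δ) :
    Integrable fun x : E2 => δ ^ 2 / (‖x‖ ^ 2 + δ ^ 2) ^ 2 := by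
  simp_rw [rescaled_eq hδ]
  exact (integrable_inv_norm_sq_add_one_sq.comp_smul (inv_ne_zero hδ.ne')).const_mul _

/-- The integral of `x ↦ δ² / (‖x‖² + δ²)²` over the plane does not depend on `δ`. -/
lemma integral_rescaled {δ : ℝ} (hδ : 0 < δ) :
    ∫ x : E2, δ ^ 2 / (‖x‖ ^ 2 + δ ^ 2) ^ 2 = ∫ x : E2, 1 / (‖x‖ ^ 2 + 1) ^ 2 := by
  simp_rw [rescaled_eq hδ]
  rw [integral_const_mul,
    Measure.integral_comp_inv_smul volume (fun x : E2 => 1 / (‖x‖ ^ 2 + 1) ^ 2) δ]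
  simp only [finrank_euclideanSpace, Fintype.card_fin, smul_eq_mul, abs_pow, sq_abs]
  field_simp

/-- The integral of `‖x‖⁻²` over an annulus. -/
lemma integral_annulus_inv_norm_sq {δ : ℝ} (hδ : 0 < δ) (hδ1 : δ ≤ 1) :
    ∫ x : E2, (Set.Ioc δ 1).indicator (fun r : ℝ => 1 / r ^ 2) ‖x‖ =
      2 * volume.real (Metric.ball (0 : E2) 1) * -Real.log δ := by
  rw [integral_fun_norm_addHaar volume ((Set.Ioc δ 1).indicator fun r : ℝ => 1 / r ^ 2)]
  have h : ∀ y : ℝ, y ^ (Module.finrank ℝ E2 - 1) •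
      (Set.Ioc δ 1).indicator (fun r : ℝ => 1 / r ^ 2) y =
      (Set.Ioc δ 1).indicator (fun r : ℝ => r⁻¹) y := by
    intro y
    by_cases hy : y ∈ Set.Ioc δ 1
    · have : y ≠ 0 := (hδ.trans hy.1).ne'
      simp [hy]
      field_simp
    · simp [hy]
  simp_rw [h]
  rw [setIntegral_indicator measurableSet_Ioc, Set.inter_eq_right.2
    (Set.Ioc_subset_Ioi_self.trans (Set.Ioi_subset_Ioi hδ.le)), ← intervalIntegral.integral_of_le hδ1,
    integral_inv_of_pos hδ one_pos]
  simp
  ring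

/-- A smooth cutoff equal to `1` on `[-2, 2]` and to `0` outside `(-4, 4)`. -/
def cutoff : ContDiffBump (0 : ℝ) := ⟨2, 4, two_pos, by norm_num⟩

lemma contDiff_cutoff {n : ℕ∞} : ContDiff ℝ n cutoff := cutoff.contDiff

lemma hasDerivAt_cutoff (s : ℝ) : HasDerivAt cutoff (deriv cutoff s) s :=
  ((contDiff_cutoff (n := 1)).differentiable (by simp) s).hasDerivAt

lemma contDiff_deriv_cutoff : ContDiff ℝ 1 (deriv cutoff) :=
  (contDiff_cutoff (n := 2)).deriv'

lemma hasDerivAt_deriv_cutoff (s : ℝ) :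
    HasDerivAt (deriv cutoff) (deriv (deriv cutoff) s) s :=
  (contDiff_deriv_cutoff.differentiable (by simp) s).hasDerivAt

lemma cutoff_eventuallyEq_one {s : ℝ} (h0 : 0 ≤ s) (h2 : s < 2) :
    cutoff =ᶠ[nhds s] fun _ => (1 : ℝ) :=
  cutoff.eventuallyEq_one_of_mem_ball (by simpa [cutoff, abs_of_nonneg h0] using h2)

lemma deriv_cutoff_eq_zero {s : ℝ} (h0 : 0 ≤ s) (h2 : s < 2) : deriv cutoff s = 0 := by
  rw [(cutoff_eventuallyEq_one h0 h2).deriv_eq, deriv_const]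

lemma deriv_deriv_cutoff_eq_zero {s : ℝ} (h0 : 0 ≤ s) (h2 : s < 2) :
    deriv (deriv cutoff) s = 0 := by
  rw [(cutoff_eventuallyEq_one h0 h2).deriv.deriv_eq]
  simp

lemma cutoff_eq_zero {s : ℝ} (h : 4 ≤ s) : cutoff s = 0 :=
  cutoff.zero_of_le_dist (by simpa [cutoff] using h.trans (le_abs_self s))

/-- A bound, uniform in `ε ≤ 1`, for the part of the Laplacian of
`cutoff (‖x‖ ^ 2) * log (‖x‖ ^ 2 + ε)` in which the cutoff is differentiated. -/
def cutoffError (s : ℝ) : ℝ :=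
  |deriv cutoff s| * (s + 2) + s ^ 2 * |deriv (deriv cutoff) s|

lemma integrable_cutoffError : Integrable fun x : E2 => cutoffError (‖x‖ ^ 2) := by
  have hc : Continuous cutoffError := by
    have h1 := contDiff_deriv_cutoff.continuous
    have h2 := contDiff_deriv_cutoff.continuous_deriv le_rfl
    unfold cutoffError
    fun_prop
  refine (hc.comp (continuous_norm.pow 2)).integrable_of_hasCompactSupport
    (HasCompactSupport.intro (isCompact_closedBall (0 : E2) 2) fun x hx => ?_)
  have hx : 4 < ‖x‖ ^ 2 := by
    simp only [Metric.mem_closedBall, dist_zero_right, not_le] at hx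
    nlinarith
  have h0 : cutoff =ᶠ[nhds (‖x‖ ^ 2)] fun _ => (0 : ℝ) := by
    filter_upwards [lt_mem_nhds hx] with s hs using cutoff_eq_zero hs.le
  have h1 : deriv cutoff (‖x‖ ^ 2) = 0 := by rw [h0.deriv_eq, deriv_const]
  have h2 : deriv (deriv cutoff) (‖x‖ ^ 2) = 0 := by
    rw [h0.deriv.deriv_eq]
    simp
  simp [cutoffError, h1, h2]

section Profile

/-- The radial profile, as a function of `s = ‖x‖ ^ 2`. -/
def profile (ε s : ℝ) : ℝ := cutoff s * Real.log (s + ε)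

/-- The derivative of `profile ε`. -/
def profileDeriv (ε s : ℝ) : ℝ := deriv cutoff s * Real.log (s + ε) + cutoff s * (s + ε)⁻¹

/-- The second derivative of `profile ε`. -/
def profileDeriv₂ (ε s : ℝ) : ℝ :=
  deriv (deriv cutoff) s * Real.log (s + ε) + 2 * deriv cutoff s * (s + ε)⁻¹
    - cutoff s / (s + ε) ^ 2

variable {ε s : ℝ}

lemma hasDerivAt_profile (hε : 0 < ε) (hs : 0 ≤ s) :
    HasDerivAt (profile ε) (profileDeriv ε s) s := by
  have hl := ((hasDerivAt_id s).add_const ε).log (by simpa using (by positivity : s + ε ≠ 0))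
  refine ((hasDerivAt_cutoff s).mul hl).congr_deriv ?_
  simp [profileDeriv]

lemma hasDerivAt_profileDeriv (hε : 0 < ε) (hs : 0 ≤ s) :
    HasDerivAt (profileDeriv ε) (profileDeriv₂ ε s) s := by
  have hne : s + ε ≠ 0 := by positivity
  have hl := ((hasDerivAt_id s).add_const ε).log (by simpa using hne)
  have hi := ((hasDerivAt_id s).add_const ε).inv (by simpa using hne)
  refine (((hasDerivAt_deriv_cutoff s).mul hl).add
    ((hasDerivAt_cutoff s).mul hi)).congr_deriv ?_
  simp [profileDeriv₂]
  ring

lemma abs_profileDeriv_add_le (hε : 0 < ε) (hε1 : ε ≤ 1) (hs : 0 ≤ s) :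
    |profileDeriv ε s + s * profileDeriv₂ ε s| ≤ ε / (s + ε) ^ 2 + cutoffError s := by
  have hpos : 0 < s + ε := by positivity
  have hsplit : profileDeriv ε s + s * profileDeriv₂ ε s = cutoff s * (ε / (s + ε) ^ 2) +
      (deriv cutoff s * (Real.log (s + ε) + 2 * (s / (s + ε))) +
        s * (deriv (deriv cutoff) s * Real.log (s + ε))) := by
    unfold profileDeriv profileDeriv₂
    field_simp
    ring
  rw [hsplit]
  refine (abs_add_le _ _).trans (add_le_add ?_ ?_)
  · rw [abs_of_nonneg (mul_nonneg cutoff.nonneg (by positivity))]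
    exact mul_le_of_le_one_left (by positivity) cutoff.le_one
  · rcases lt_or_ge s 1 with h | h
    · simp [cutoffError, deriv_cutoff_eq_zero hs (h.trans one_lt_two),
         deriv_deriv_cutoff_eq_zero hs (h.trans one_lt_two)]
    · have hl0 : 0 ≤ Real.log (s + ε) := Real.log_nonneg (by linarith)
      have hl : Real.log (s + ε) ≤ s := by
        have := Real.log_le_sub_one_of_pos hpos
        linarith
      have hq : s / (s + ε) ≤ 1 := (div_le_one hpos).2 (by linarith)
      have hq0 : 0 ≤ s / (s + ε) := by positivity
      refine (abs_add_le _ _).trans (add_le_add ?_ ?_)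
      · rw [abs_mul, abs_of_nonneg (by positivity : 0 ≤ Real.log (s + ε) + 2 * (s / (s + ε)))]
        gcongr
        linarith
      · rw [abs_mul, abs_mul, abs_of_nonneg hs, abs_of_nonneg hl0, sq, mul_assoc,
          mul_comm |_| (Real.log _)]
        gcongr

lemma contDiff_profile_norm_sq (hε : 0 < ε) :
    ContDiff ℝ (⊤ : ℕ∞) fun x : E2 => profile ε (‖x‖ ^ 2) := by
  have hn : ContDiff ℝ (⊤ : ℕ∞) fun x : E2 => ‖x‖ ^ 2 := contDiff_norm_sq ℝ
  exact (contDiff_cutoff.comp hn).mul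
    ((hn.add contDiff_const).log fun x => by positivity)

lemma hasCompactSupport_profile_norm_sq :
    HasCompactSupport fun x : E2 => profile ε (‖x‖ ^ 2) := by
  refine HasCompactSupport.intro (isCompact_closedBall (0 : E2) 2) fun x hx => ?_
  have hx : 4 ≤ ‖x‖ ^ 2 := by
    simp only [Metric.mem_closedBall, dist_zero_right, not_le] at hx
    nlinarith
  simp [profile, cutoff_eq_zero hx]

end Profile

/-- The Laplacians of the test functions are bounded in `L¹`. -/
lemma integral_abs_lapR_profile_le {δ : ℝ} (hδ : 0 < δ) (hδ1 : δ ≤ 1) :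
    ∫ x : E2, |lapR (fun x => profile (δ ^ 2) (‖x‖ ^ 2)) x| ≤
      4 * ((∫ x : E2, 1 / (‖x‖ ^ 2 + 1) ^ 2) + ∫ x : E2, cutoffError (‖x‖ ^ 2)) := by
  have hε : 0 < δ ^ 2 := by positivity
  rw [← integral_rescaled hδ, ← integral_add (integrable_rescaled hδ) integrable_cutoffError,
    ← integral_const_mul]
  refine integral_mono_of_nonneg (Filter.Eventually.of_forall fun x => abs_nonneg _)
    (((integrable_rescaled hδ).add integrable_cutoffError).const_mul 4)
    (Filter.Eventually.of_forall fun x => ?_)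
  simp only [lapR_comp_norm_sq (fun s => hasDerivAt_profile hε)
    (fun s => hasDerivAt_profileDeriv hε)]
  rw [abs_mul, abs_of_pos (by norm_num : (0 : ℝ) < 4)]
  exact mul_le_mul_of_nonneg_left
    (abs_profileDeriv_add_le hε (pow_le_one₀ hδ.le hδ1) (sq_nonneg _)) (by norm_num)

lemma continuous_pdR {u : E2 → ℝ} (hu : ContDiff ℝ (⊤ : ℕ∞) u) (i : Fin 2) :
    Continuous (pdR i u) :=
  (hu.continuous_fderiv (by simp)).clm_apply continuous_const

lemma integrable_gradient_sq {u : E2 → ℝ} (hu : ContDiff ℝ (⊤ : ℕ∞) u)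
    (hs : HasCompactSupport u) : Integrable fun x => pdR 0 u x ^ 2 + pdR 1 u x ^ 2 := by
  refine (((continuous_pdR hu 0).pow 2).add
    ((continuous_pdR hu 1).pow 2)).integrable_of_hasCompactSupport
    ((hs.fderiv (𝕜 := ℝ)).mono fun x hx h => hx ?_)
  simp [pdR, Function.notMem_support.1 (not_not.2 h)]

/-- The Dirichlet integrals of the test functions grow logarithmically. -/
lemma le_integral_gradient_sq_profile {δ : ℝ} (hδ : 0 < δ) (hδ1 : δ ≤ 1) :
    2 * volume.real (Metric.ball (0 : E2) 1) * -Real.log δ ≤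
      ∫ x : E2, (pdR 0 (fun x => profile (δ ^ 2) (‖x‖ ^ 2)) x ^ 2 +
        pdR 1 (fun x => profile (δ ^ 2) (‖x‖ ^ 2)) x ^ 2) := by
  have hε : 0 < δ ^ 2 := by positivity
  rw [← integral_annulus_inv_norm_sq hδ hδ1]
  refine integral_mono_of_nonneg (Filter.Eventually.of_forall fun x =>
      Set.indicator_nonneg (fun r _ => by positivity) _)
    (integrable_gradient_sq (contDiff_profile_norm_sq hε) hasCompactSupport_profile_norm_sq)
    (Filter.Eventually.of_forall fun x => ?_)
  refine Set.indicator_apply_le' (fun hx => ?_) (fun _ => by positivity)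
  obtain ⟨h1, h2⟩ := hx
  have hx0 : 0 < ‖x‖ := hδ.trans h1
  have hle : δ ^ 2 ≤ ‖x‖ ^ 2 := by gcongr
  have hE : pdR 0 (fun x => profile (δ ^ 2) (‖x‖ ^ 2)) x ^ 2 +
      pdR 1 (fun x => profile (δ ^ 2) (‖x‖ ^ 2)) x ^ 2 =
      4 * ‖x‖ ^ 2 * profileDeriv (δ ^ 2) (‖x‖ ^ 2) ^ 2 := by
    simp only [pdR_comp_norm_sq (fun s => hasDerivAt_profile hε)]
    linear_combination (-4 * profileDeriv (δ ^ 2) (‖x‖ ^ 2) ^ 2) * norm_sq_eq_coord x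
  have hD : 1 / (2 * ‖x‖ ^ 2) ≤ profileDeriv (δ ^ 2) (‖x‖ ^ 2) := by
    have h2 : ‖x‖ ^ 2 < 2 := (pow_le_one₀ hx0.le h2).trans_lt one_lt_two
    rw [profileDeriv, deriv_cutoff_eq_zero (sq_nonneg _) h2,
      (cutoff_eventuallyEq_one (sq_nonneg _) h2).eq_of_nhds, zero_mul, zero_add, one_mul,
      ← one_div]
    gcongr
    linarith
  refine le_of_le_of_eq ?_ hE.symm
  calc 1 / ‖x‖ ^ 2 = 4 * ‖x‖ ^ 2 * (1 / (2 * ‖x‖ ^ 2)) ^ 2 := by field_simp; norm_num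
    _ ≤ _ := by gcongr


/-- There is no constant `C > 0` with `∫ |∇u|² ≤ C (∫ |Δu|)²` for all
`u ∈ C_0^∞(ℝ²)`: for every `C > 0` some test function violates the bound. -/
theorem no_dirichlet_estimate_by_laplacian :
    ∀ C : ℝ, 0 < C → ∃ u : E2 → ℝ, ContDiff ℝ (⊤ : ℕ∞) u ∧ HasCompactSupport u ∧
      C * (∫ x : E2, |lapR u x|) ^ 2 <
        ∫ x : E2, ((pdR 0 u x) ^ 2 + (pdR 1 u x) ^ 2) := by
  intro C hC
  set K : ℝ := 4 * ((∫ x : E2, 1 / (‖x‖ ^ 2 + 1) ^ 2) + ∫ x : E2, cutoffError (‖x‖ ^ 2))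
  set V : ℝ := volume.real (Metric.ball (0 : E2) 1)
  have hV : 0 < V := ENNReal.toReal_pos (Metric.measure_ball_pos volume _ one_pos).ne'
    measure_ball_lt_top.ne
  set T : ℝ := C * K ^ 2 / V
  have hT : 0 ≤ T := by positivity
  have hδ := Real.exp_pos (-(T + 1))
  have hδ1 : Real.exp (-(T + 1)) ≤ 1 := Real.exp_le_one_iff.2 (by linarith)
  refine ⟨_, contDiff_profile_norm_sq (pow_pos hδ 2), hasCompactSupport_profile_norm_sq,
    lt_of_lt_of_le ?_ (le_integral_gradient_sq_profile hδ hδ1)⟩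
  calc _ ≤ C * K ^ 2 := by
        gcongr
        exact integral_abs_lapR_profile_le hδ hδ1
    _ = V * T := by simp only [T]; field_simp
    _ < _ := by
        rw [Real.log_exp]
        nlinarith
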